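/- Let n ≥ 1. The group Inn(O*ₙ) of inner automorphisms is a normal subgroup of Aut(O*ₙ), the quotient Aut(O*ₙ)/Inn(O*ₙ) is isomorphic to ℤ/2 × ℤ/3^(n−1), and the corresponding short exact sequence 1 → Inn(O*ₙ) → Aut(O*ₙ) → ℤ/2 × ℤ/3^(n−1) → 1 splits: there is a subgroup of Aut(O*ₙ) isomorphic to ℤ/2 × ℤ/3^(n−1) which intersects Inn(O*ₙ) trivially and maps isomorphically onto the quotient. In particular such a complement is generated by the automorphisms φ, ψ ∈ Aut(O*ₙ) determined on generators by φ(P) = P, φ(Q) = Q, φ(X) = X, φ(R) = R⁻¹ and ψ(P) = P, ψ(Q) = Q, ψ(X) = X⁴, ψ(R) = R. -/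

import Mathlib

/-- Generators `X, P, Q, R` of the generalized binary octahedral group. -/
inductive OGen : Type
  | X : OGen
  | P : OGen
  | Q : OGen
  | R : OGen
  deriving DecidableEq

open OGen FreeGroup in
/-- The relations of the generalized binary octahedral group `O*ₙ`:
`X^(3^n) = P⁴ = 1`, `P² = Q² = R²`, `PQP⁻¹ = Q⁻¹`, `XPX⁻¹ = Q`, `XQX⁻¹ = PQ`,
`RXR⁻¹ = X⁻¹`, `RPR⁻¹ = QP`, `RQR⁻¹ = Q⁻¹`. -/
def ostarRels (n : ℕ) : Set (FreeGroup OGen) :=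
  { of X ^ 3 ^ n,
    of P ^ 4,
    of P ^ 2 * (of Q ^ 2)⁻¹,
    of Q ^ 2 * (of R ^ 2)⁻¹,
    of P * of Q * (of P)⁻¹ * of Q,
    of X * of P * (of X)⁻¹ * (of Q)⁻¹,
    of X * of Q * (of X)⁻¹ * (of P * of Q)⁻¹,
    of R * of X * (of R)⁻¹ * of X,
    of R * of P * (of R)⁻¹ * (of Q * of P)⁻¹,
    of R * of Q * (of R)⁻¹ * of Q }

/-- The generalized binary octahedral group `O*ₙ`, given by the presentation above. -/
abbrev Ostar (n : ℕ) := PresentedGroup (ostarRels n)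


/-- The relations of `O*ₙ` for four elements of a group. -/
structure OR (n : ℕ) {G : Type*} [Group G] (x p q r : G) : Prop where
  hx : x ^ 3 ^ n = 1
  p4 : p ^ 4 = 1
  pq2 : p ^ 2 = q ^ 2
  qr2 : q ^ 2 = r ^ 2
  pq : p * q = q⁻¹ * p
  xp : x * p = q * x
  xq : x * q = p * q * x
  rx : r * x = x⁻¹ * r
  rp : r * p = q * p * r
  rq : r * q = q⁻¹ * r

namespace OR
variable {n : ℕ} {G : Type*} [Group G] {x p q r : G}

theorem qp (h : OR n x p q r) : q * p = p⁻¹ * q := by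
  have h1 := h.pq; have h2 := h.pq2; have h4 := h.p4
  -- q p = p q⁻¹ ... from p q = q⁻¹ p
  have h3 : q * p * q = p := by rw [mul_assoc, h1]; group
  have h6 : p * q * p = q := by
    have : p * q * p = q⁻¹ * p ^ 2 := by rw [h1, pow_two, mul_assoc]
    rw [this, h2]; group
  calc q * p = p⁻¹ * (p * q * p) := by group
    _ = _ := by rw [h6]

theorem x3p (h : OR n x p q r) : Commute (x ^ 3) p := by
  have a := h.xp; have b := h.xq; have c := h.qp
  have e : q * p * q = p := by rw [mul_assoc, h.pq]; group
  show x ^ 3 * p = p * x ^ 3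
  calc x ^ 3 * p = x * (x * (x * p)) := by simp only [pow_succ, pow_zero, one_mul, mul_assoc]
    _ = x * ((x * q) * x) := by rw [a]; group
    _ = (x * p) * q * x * x := by rw [b]; group
    _ = q * (x * q) * x * x := by rw [a]; group
    _ = (q * p * q) * x ^ 3 := by
        rw [b]; simp only [pow_succ, pow_zero, one_mul, mul_assoc]
    _ = _ := by rw [e]

theorem x3q (h : OR n x p q r) : Commute (x ^ 3) q := by
  have e : q = x * p * x⁻¹ := by rw [h.xp]; group
  have c := h.x3p
  have d : Commute (x ^ 3) x := (Commute.refl x).pow_left 3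
  rw [e]
  exact (d.mul_right c).mul_right d.inv_right

theorem xip (h : OR n x p q r) : x⁻¹ * p = p * q * x⁻¹ := by
  have a := h.xp; have b := h.xq
  have e : q * p * q = p := by rw [mul_assoc, h.pq]; group
  have : x * (p * q) = p * x := by
    rw [← mul_assoc, a, mul_assoc, b, ← mul_assoc, ← mul_assoc, e]
  rw [inv_mul_eq_iff_eq_mul, ← mul_assoc, this]; group

theorem xiq (h : OR n x p q r) : x⁻¹ * q = p * x⁻¹ := by
  rw [inv_mul_eq_iff_eq_mul, ← mul_assoc, h.xp]; group

theorem rip (h : OR n x p q r) : r⁻¹ * p = q * p * r⁻¹ := by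
  have : r * (q * p) = p * r := by
    rw [← mul_assoc, h.rq, mul_assoc, h.rp]; group
  rw [inv_mul_eq_iff_eq_mul, ← mul_assoc, this]; group

theorem riq (h : OR n x p q r) : r⁻¹ * q = q⁻¹ * r⁻¹ := by
  have : r * q⁻¹ = q * r := by
    have := h.rq
    rw [mul_inv_eq_iff_eq_mul, mul_assoc, this]; group
  rw [inv_mul_eq_iff_eq_mul, ← mul_assoc, this]; group

theorem rix (h : OR n x p q r) : r⁻¹ * x = x⁻¹ * r⁻¹ := by
  have : r * x⁻¹ = x * r := by
    have := h.rx
    rw [mul_inv_eq_iff_eq_mul, mul_assoc, this]; group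
  rw [inv_mul_eq_iff_eq_mul, ← mul_assoc, this]; group

/-- `φ` respects the relations. -/
theorem phi (h : OR n x p q r) : OR n x p q r⁻¹ where
  hx := h.hx
  p4 := h.p4
  pq2 := h.pq2
  qr2 := by
    have := h.p4
    have h1 := h.pq2; have h2 := h.qr2
    rw [inv_pow, ← h2, ← h1, eq_inv_iff_mul_eq_one, ← pow_add, this]
  pq := h.pq
  xp := h.xp
  xq := h.xq
  rx := h.rix
  rp := h.rip
  rq := h.riq

/-- `ψ` respects the relations. -/
theorem psi (h : OR n x p q r) : OR n (x ^ 4) p q r where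
  hx := by rw [← pow_mul, mul_comm, pow_mul, h.hx, one_pow]
  p4 := h.p4
  pq2 := h.pq2
  qr2 := h.qr2
  pq := h.pq
  xp := by
    rw [pow_succ', mul_assoc, h.x3p.eq, ← mul_assoc, h.xp, mul_assoc]
  xq := by
    rw [pow_succ', mul_assoc, h.x3q.eq, ← mul_assoc, h.xq, mul_assoc]
  rx := by
    have : SemiconjBy r x x⁻¹ := h.rx
    have := this.pow_right 4
    rw [inv_pow] at this
    exact this
  rp := h.rp
  rq := h.rq

theorem N_word (h : OR n x p q r) {g : G} (hg : g ∈ Subgroup.closure {p, q}) :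
    ∃ (a : Fin 4) (b : Fin 2), g = p ^ (a : ℕ) * q ^ (b : ℕ) := by
  have h1 : ∃ a b : ℤ, g = p ^ a * q ^ b := by
    induction hg using Subgroup.closure_induction_left with
    | one => exact ⟨0, 0, by simp⟩
    | mul_left y hy z hz ih =>
      obtain ⟨a, b, rfl⟩ := ih
      rcases hy with rfl | rfl
      · exact ⟨a + 1, b, by group⟩
      · refine ⟨-a, b + 1, ?_⟩
        have : SemiconjBy y p p⁻¹ := h.qp
        have := (this.zpow_right a).eq
        rw [← mul_assoc, this, inv_zpow']; group
    | inv_mul_cancel y hy z hz ih =>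
      obtain ⟨a, b, rfl⟩ := ih
      rcases hy with rfl | rfl
      · exact ⟨a - 1, b, by group⟩
      · refine ⟨-a, b - 1, ?_⟩
        have : SemiconjBy y p p⁻¹ := h.qp
        have := (this.inv_right.inv_symm_left).zpow_right a
        rw [inv_inv] at this
        have := this.eq
        rw [← mul_assoc, this, inv_zpow']; group
  obtain ⟨a, b, rfl⟩ := h1
  have hq : q ^ b = p ^ (2 * (b / 2)) * q ^ (b % 2) := by
    rw [zpow_mul]
    have : p ^ (2 : ℤ) = q ^ (2 : ℤ) := by exact_mod_cast h.pq2
    rw [this, ← zpow_mul, ← zpow_add, Int.mul_ediv_add_emod]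
  have hp : ∀ c : ℤ, p ^ c = p ^ (c % 4) := by
    intro c
    have : p ^ (4 : ℤ) = 1 := by exact_mod_cast h.p4
    conv_lhs => rw [← Int.mul_ediv_add_emod c 4, zpow_add, zpow_mul, this, one_zpow, one_mul]
  rw [hq, ← mul_assoc, ← zpow_add, hp]
  have e1 : 0 ≤ (a + 2 * (b / 2)) % 4 := by omega
  have e2 : 0 ≤ b % 2 := by omega
  obtain ⟨u, hu⟩ := Int.eq_ofNat_of_zero_le e1
  obtain ⟨v, hv⟩ := Int.eq_ofNat_of_zero_le e2
  refine ⟨⟨u, by omega⟩, ⟨v, by omega⟩, ?_⟩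
  rw [hu, hv]; simp

theorem N_conj (h : OR n x p q r) (hG : Subgroup.closure {x, p, q, r} = ⊤) :
    (Subgroup.closure {p, q}).Normal := by
  set N := Subgroup.closure {p, q} with hN
  have hp : p ∈ N := Subgroup.subset_closure (by simp)
  have hq : q ∈ N := Subgroup.subset_closure (by simp)
  have key : ∀ g : G, g * p * g⁻¹ ∈ N → g * q * g⁻¹ ∈ N → ∀ m ∈ N, g * m * g⁻¹ ∈ N := by
    intro g h1 h2 m hm
    have : N ≤ N.comap (MulAut.conj g).toMonoidHom := by
      conv_lhs => rw [hN]
      rw [Subgroup.closure_le]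
      rintro y (rfl | rfl)
      · exact h1
      · exact h2
    exact this hm
  have key2 : ∀ g : G, (∀ m ∈ N, g * m * g⁻¹ ∈ N) → (∀ m ∈ N, g⁻¹ * m * g ∈ N) →
      g ∈ Subgroup.normalizer (N : Set G) := by
    intro g h1 h2
    rw [Subgroup.mem_normalizer_iff]
    intro m
    refine ⟨h1 m, fun hm => ?_⟩
    have := h2 _ hm
    have e : g⁻¹ * (g * m * g⁻¹) * g = m := by group
    rwa [e] at this
  rw [← Subgroup.normalizer_eq_top_iff, eq_top_iff, ← hG, Subgroup.closure_le]
  have hle := Subgroup.le_normalizer (H := N)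
  rintro y (rfl | rfl | rfl | rfl)
  · apply key2
    · apply key
      · rw [h.xp]; simpa using hq
      · rw [h.xq]; simpa using N.mul_mem hp hq
    · have := key y⁻¹
      rw [inv_inv] at this
      apply this
      · rw [h.xip]; simpa using N.mul_mem hp hq
      · rw [h.xiq]; simpa using hp
  · exact hle hp
  · exact hle hq
  · apply key2
    · apply key
      · rw [h.rp]; simpa using N.mul_mem hq hp
      · rw [h.rq]; simpa using hq
    · have := key y⁻¹
      rw [inv_inv] at this
      apply this
      · rw [h.rip]; simpa using N.mul_mem hq hp
      · rw [h.riq]; simpa using hq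

theorem word (h : OR n x p q r) (hG : Subgroup.closure {x, p, q, r} = ⊤) (g : G) :
    ∃ (k : ℤ) (a : Fin 4) (b : Fin 2) (i : Fin 3) (j : Fin 2),
      g = x ^ (3 * k) * (p ^ (a : ℕ) * q ^ (b : ℕ) * x ^ (i : ℕ) * r ^ (j : ℕ)) := by
  have hnorm := h.N_conj hG
  have h1 : ∃ m ∈ Subgroup.closure {p, q}, ∃ i j : ℤ, g = m * x ^ i * r ^ j := by
    have hg : g ∈ Subgroup.closure {x, p, q, r} := by rw [hG]; trivial
    have hp : p ∈ Subgroup.closure {p, q} := Subgroup.subset_closure (by simp)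
    have hq : q ∈ Subgroup.closure {p, q} := Subgroup.subset_closure (by simp)
    induction hg using Subgroup.closure_induction_left with
    | one => exact ⟨1, one_mem _, 0, 0, by simp⟩
    | mul_left y hy z hz ih =>
      obtain ⟨m, hm, i, j, rfl⟩ := ih
      rcases hy with rfl | rfl | rfl | rfl
      · exact ⟨_, hnorm.conj_mem m hm y, i + 1, j, by group⟩
      · exact ⟨_, mul_mem hp hm, i, j, by group⟩
      · exact ⟨_, mul_mem hq hm, i, j, by group⟩
      · refine ⟨_, hnorm.conj_mem m hm y, -i, j + 1, ?_⟩
        have : SemiconjBy y x x⁻¹ := h.rx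
        have := (this.zpow_right i).eq
        rw [inv_zpow'] at this
        calc y * (m * x ^ i * y ^ j) = y * m * y⁻¹ * (y * x ^ i) * y ^ j := by group
          _ = _ := by rw [this]; group
    | inv_mul_cancel y hy z hz ih =>
      obtain ⟨m, hm, i, j, rfl⟩ := ih
      rcases hy with rfl | rfl | rfl | rfl
      · exact ⟨_, hnorm.conj_mem m hm y⁻¹, i - 1, j, by group⟩
      · exact ⟨_, mul_mem (inv_mem hp) hm, i, j, by group⟩
      · exact ⟨_, mul_mem (inv_mem hq) hm, i, j, by group⟩
      · refine ⟨_, hnorm.conj_mem m hm y⁻¹, -i, j - 1, ?_⟩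
        have : SemiconjBy y⁻¹ x x⁻¹ := h.rix
        have := (this.zpow_right i).eq
        rw [inv_zpow'] at this
        calc y⁻¹ * (m * x ^ i * y ^ j) = y⁻¹ * m * y⁻¹⁻¹ * (y⁻¹ * x ^ i) * y ^ j := by group
          _ = _ := by rw [this]; group
  obtain ⟨m, hm, i, j, rfl⟩ := h1
  -- reduce the exponent of r, using r ^ 2 = p ^ 2 commuting with x
  have hrx : Commute (r ^ (2 * (j / 2))) (x ^ i) := by
    have e : SemiconjBy r x x⁻¹ := h.rx
    have e2 : SemiconjBy r x⁻¹ x := by simpa using e.inv_right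
    have : Commute (r * r) x := e2.mul_left e
    rw [← pow_two] at this
    rw [zpow_mul]
    exact_mod_cast (this.zpow_left _).zpow_right i
  have hr2 : r ^ (2 * (j / 2)) ∈ Subgroup.closure {p, q} := by
    rw [zpow_mul]
    refine zpow_mem ?_ _
    have : r ^ (2 : ℤ) = p ^ 2 := by rw [h.pq2, h.qr2]; norm_cast
    rw [this]
    exact pow_mem (Subgroup.subset_closure (by simp)) _
  have hrj : r ^ j = r ^ (2 * (j / 2)) * r ^ (j % 2) := by
    rw [← zpow_add, Int.mul_ediv_add_emod]
  obtain ⟨a, b, hab⟩ := h.N_word (mul_mem hm hr2)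
  have e1 : 0 ≤ i % 3 := by omega
  have e2 : 0 ≤ j % 2 := by omega
  obtain ⟨u, hu⟩ := Int.eq_ofNat_of_zero_le e1
  obtain ⟨v, hv⟩ := Int.eq_ofNat_of_zero_le e2
  refine ⟨i / 3, a, b, ⟨u, by omega⟩, ⟨v, by omega⟩, ?_⟩
  have hxi : x ^ i = x ^ (3 * (i / 3)) * x ^ (i % 3) := by
    rw [← zpow_add, Int.mul_ediv_add_emod]
  have hc : Commute (x ^ (3 * (i / 3))) (p ^ (a : ℕ) * q ^ (b : ℕ)) := by
    rw [zpow_mul]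
    have c1 := h.x3p; have c2 := h.x3q
    exact_mod_cast ((c1.pow_right a).mul_right (c2.pow_right b)).zpow_left (i / 3)
  calc m * x ^ i * r ^ j = m * (x ^ i * r ^ (2 * (j / 2))) * r ^ (j % 2) := by
        rw [hrj]; simp only [mul_assoc]
    _ = (m * r ^ (2 * (j / 2))) * x ^ i * r ^ (j % 2) := by
        rw [← hrx.eq]; simp only [mul_assoc]
    _ = (p ^ (a : ℕ) * q ^ (b : ℕ) * x ^ (3 * (i / 3))) * x ^ (i % 3) * r ^ (j % 2) := by
        rw [hab, hxi]; simp only [mul_assoc]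
    _ = _ := by
        rw [← hc.eq, hu, hv]; simp only [mul_assoc, zpow_natCast]

end OR

/-- Determinant one matrices over `ℤ/7`. -/
@[ext] structure M7 where
  a : ZMod 7
  b : ZMod 7
  c : ZMod 7
  d : ZMod 7
  det : a * d - b * c = 1

namespace M7

instance : DecidableEq M7 := fun s t =>
  decidable_of_iff (s.a = t.a ∧ s.b = t.b ∧ s.c = t.c ∧ s.d = t.d) M7.ext_iff.symm

instance : Group M7 where
  mul s t := ⟨s.a * t.a + s.b * t.c, s.a * t.b + s.b * t.d,
    s.c * t.a + s.d * t.c, s.c * t.b + s.d * t.d, by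
      linear_combination (s.a * s.d - s.b * s.c) * t.det + s.det⟩
  one := ⟨1, 0, 0, 1, by ring⟩
  inv s := ⟨s.d, -s.b, -s.c, s.a, by linear_combination s.det⟩
  mul_assoc s t u := by
    apply M7.ext
    · show (s.a * t.a + s.b * t.c) * u.a + (s.a * t.b + s.b * t.d) * u.c =
        s.a * (t.a * u.a + t.b * u.c) + s.b * (t.c * u.a + t.d * u.c)
      ring
    · show (s.a * t.a + s.b * t.c) * u.b + (s.a * t.b + s.b * t.d) * u.d =
        s.a * (t.a * u.b + t.b * u.d) + s.b * (t.c * u.b + t.d * u.d)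
      ring
    · show (s.c * t.a + s.d * t.c) * u.a + (s.c * t.b + s.d * t.d) * u.c =
        s.c * (t.a * u.a + t.b * u.c) + s.d * (t.c * u.a + t.d * u.c)
      ring
    · show (s.c * t.a + s.d * t.c) * u.b + (s.c * t.b + s.d * t.d) * u.d =
        s.c * (t.a * u.b + t.b * u.d) + s.d * (t.c * u.b + t.d * u.d)
      ring
  one_mul s := by
    apply M7.ext
    · show 1 * s.a + 0 * s.c = s.a
      ring
    · show 1 * s.b + 0 * s.d = s.b
      ring
    · show 0 * s.a + 1 * s.c = s.c
      ring
    · show 0 * s.b + 1 * s.d = s.d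
      ring
  mul_one s := by
    apply M7.ext
    · show s.a * 1 + s.b * 0 = s.a
      ring
    · show s.a * 0 + s.b * 1 = s.b
      ring
    · show s.c * 1 + s.d * 0 = s.c
      ring
    · show s.c * 0 + s.d * 1 = s.d
      ring
  inv_mul_cancel s := by
    apply M7.ext
    · show s.d * s.a + -s.b * s.c = 1
      linear_combination s.det
    · show s.d * s.b + -s.b * s.d = 0
      ring
    · show -s.c * s.a + s.a * s.c = 0
      ring
    · show -s.c * s.b + s.a * s.d = 1
      linear_combination s.det

def P : M7 := ⟨0, 1, 6, 0, by decide⟩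
def Q : M7 := ⟨2, 3, 3, 5, by decide⟩
def X : M7 := ⟨4, 6, 0, 2, by decide⟩
def R : M7 := ⟨1, 6, 2, 6, by decide⟩

theorem X3 : X ^ 3 = 1 := by decide

theorem rels {n : ℕ} (hn : 1 ≤ n) : OR n X P Q R where
  hx := by
    obtain ⟨m, rfl⟩ : ∃ m, n = m + 1 := ⟨n - 1, by omega⟩
    rw [pow_succ', pow_mul, X3, one_pow]
  p4 := by decide
  pq2 := by decide
  qr2 := by decide
  pq := by decide
  xp := by decide
  xq := by decide
  rx := by decide
  rp := by decide
  rq := by decide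

/-- the words -/
def W (a : Fin 4) (b : Fin 2) (i : Fin 3) (j : Fin 2) : M7 :=
  P ^ (a : ℕ) * Q ^ (b : ℕ) * X ^ (i : ℕ) * R ^ (j : ℕ)

set_option maxRecDepth 100000 in
theorem W_comm : ∀ a b i j, W a b i j * P = P * W a b i j → W a b i j * Q = Q * W a b i j →
    i = 0 ∧ j = 0 ∧ b = 0 ∧ (a = 0 ∨ a = 2) := by
  decide

theorem PQ_inj : ∀ (a : Fin 4) (b : Fin 2), P ^ (a : ℕ) * Q ^ (b : ℕ) = 1 → a = 0 ∧ b = 0 := by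
  decide

set_option maxRecDepth 100000 in
theorem W_trans : ∀ (a : Fin 4) (b : Fin 2) (c : Fin 4) (d : Fin 2),
    (P ^ (a : ℕ) * Q ^ (b : ℕ)) ^ 2 ≠ 1 →
    (P ^ (a : ℕ) * Q ^ (b : ℕ)) ^ 2 = (P ^ (c : ℕ) * Q ^ (d : ℕ)) ^ 2 →
    (P ^ (a : ℕ) * Q ^ (b : ℕ)) * (P ^ (c : ℕ) * Q ^ (d : ℕ)) ≠
      (P ^ (c : ℕ) * Q ^ (d : ℕ)) * (P ^ (a : ℕ) * Q ^ (b : ℕ)) →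
    ∃ (b₁ : Fin 2) (a₁ : Fin 4) (i : Fin 3) (j : Fin 2),
      W a₁ b₁ i j * P = P ^ (a : ℕ) * Q ^ (b : ℕ) * W a₁ b₁ i j ∧
      W a₁ b₁ i j * Q = P ^ (c : ℕ) * Q ^ (d : ℕ) * W a₁ b₁ i j := by
  decide

end M7

theorem four_pow_three_pow (n : ℕ) : ∃ v : ℤ, (4 : ℤ) ^ 3 ^ n = 1 + 3 ^ (n + 1) * (1 + 3 * v) := by
  induction n with
  | zero => exact ⟨0, by norm_num⟩
  | succ n ih =>
    obtain ⟨v, hv⟩ := ih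
    refine ⟨v + 3 ^ n * (1 + 3 * v) ^ 2 + 3 ^ (2 * n) * (1 + 3 * v) ^ 3, ?_⟩
    rw [pow_succ 3 n, pow_mul, hv]
    ring

theorem exists_four_pow (n : ℕ) (l : ℤ) : ∃ m : ℕ, (3 : ℤ) ^ (n + 1) ∣ 4 ^ m - (1 + 3 * l) := by
  induction n with
  | zero => exact ⟨0, -l, by ring⟩
  | succ n ih =>
    obtain ⟨m, t, ht⟩ := ih
    obtain ⟨v, hv⟩ := four_pow_three_pow n
    obtain ⟨y, hy⟩ : ∃ y : ℤ, (4 : ℤ) ^ m = 1 + 3 * y := by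
      have : (4 : ℤ) - 1 ∣ 4 ^ m - 1 := by simpa using sub_dvd_pow_sub_pow (4 : ℤ) 1 m
      obtain ⟨y, hy⟩ := this
      exact ⟨y, by linarith⟩
    have h3 : t % 3 = 0 ∨ t % 3 = 1 ∨ t % 3 = 2 := by omega
    rcases h3 with h | h | h
    · obtain ⟨s, rfl⟩ : ∃ s, t = 3 * s := ⟨t / 3, by omega⟩
      exact ⟨m, s, by rw [ht]; ring⟩
    · obtain ⟨s, rfl⟩ : ∃ s, t = 3 * s + 1 := ⟨t / 3, by omega⟩
      refine ⟨m + 3 ^ n * 2, s + 1 + 2 * (v + y + 3 * v * y) +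
        3 ^ n * (1 + 3 * v) ^ 2 * (1 + 3 * y), ?_⟩
      rw [pow_add, pow_mul, hv, hy]
      rw [hy] at ht
      linear_combination ht
    · obtain ⟨s, rfl⟩ : ∃ s, t = 3 * s + 2 := ⟨t / 3, by omega⟩
      refine ⟨m + 3 ^ n, s + 1 + v + y + 3 * v * y, ?_⟩
      rw [pow_add, hv, hy]
      rw [hy] at ht
      linear_combination ht

namespace Ostar

/-- generator -/
abbrev x (n : ℕ) : Ostar n := PresentedGroup.of OGen.X
/-- generator -/
abbrev p (n : ℕ) : Ostar n := PresentedGroup.of OGen.P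
/-- generator -/
abbrev q (n : ℕ) : Ostar n := PresentedGroup.of OGen.Q
/-- generator -/
abbrev r (n : ℕ) : Ostar n := PresentedGroup.of OGen.R

theorem rel (n : ℕ) : OR n (x n) (p n) (q n) (r n) := by
  have key : ∀ w ∈ ostarRels n, PresentedGroup.mk (ostarRels n) w = 1 := fun w hw =>
    PresentedGroup.one_of_mem hw
  simp only [ostarRels, Set.mem_insert_iff, Set.mem_singleton_iff, forall_eq_or_imp, forall_eq] at key
  obtain ⟨h1, h2, h3, h4, h5, h6, h7, h8, h9, h10⟩ := key
  refine ⟨h1, h2, mul_inv_eq_one.mp h3, mul_inv_eq_one.mp h4, ?_, ?_, ?_, ?_, ?_, ?_⟩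
  · exact mul_inv_eq_iff_eq_mul.mp (eq_inv_of_mul_eq_one_left h5)
  · exact mul_inv_eq_iff_eq_mul.mp (mul_inv_eq_one.mp h6)
  · exact mul_inv_eq_iff_eq_mul.mp (mul_inv_eq_one.mp h7)
  · exact mul_inv_eq_iff_eq_mul.mp (eq_inv_of_mul_eq_one_left h8)
  · exact mul_inv_eq_iff_eq_mul.mp (mul_inv_eq_one.mp h9)
  · exact mul_inv_eq_iff_eq_mul.mp (eq_inv_of_mul_eq_one_left h10)

variable {n : ℕ} {G : Type*} [Group G]

theorem exists_lift {a b c d : G} (h : OR n a b c d) :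
    ∃ f : Ostar n →* G, f (x n) = a ∧ f (p n) = b ∧ f (q n) = c ∧ f (r n) = d := by
  let F : OGen → G := fun g => match g with
    | OGen.X => a
    | OGen.P => b
    | OGen.Q => c
    | OGen.R => d
  have hF : ∀ w ∈ ostarRels n, FreeGroup.lift F w = 1 := by
    simp only [ostarRels, Set.mem_insert_iff, Set.mem_singleton_iff, forall_eq_or_imp, forall_eq,
      map_mul, map_pow, map_inv, FreeGroup.lift_apply_of]
    refine ⟨h.hx, h.p4, mul_inv_eq_one.mpr h.pq2, mul_inv_eq_one.mpr h.qr2, ?_, ?_, ?_, ?_, ?_, ?_⟩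
    · show b * c * b⁻¹ * c = 1
      rw [h.pq]; group
    · show a * b * a⁻¹ * c⁻¹ = 1
      rw [h.xp]; group
    · show a * c * a⁻¹ * (b * c)⁻¹ = 1
      rw [h.xq]; group
    · show d * a * d⁻¹ * a = 1
      rw [h.rx]; group
    · show d * b * d⁻¹ * (c * b)⁻¹ = 1
      rw [h.rp]; group
    · show d * c * d⁻¹ * c = 1
      rw [h.rq]; group
  exact ⟨PresentedGroup.toGroup hF, PresentedGroup.toGroup.of hF, PresentedGroup.toGroup.of hF,
    PresentedGroup.toGroup.of hF, PresentedGroup.toGroup.of hF⟩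

theorem hext {f g : Ostar n →* G} (h1 : f (x n) = g (x n)) (h2 : f (p n) = g (p n))
    (h3 : f (q n) = g (q n)) (h4 : f (r n) = g (r n)) : f = g := by
  apply PresentedGroup.ext
  rintro (_ | _ | _ | _) <;> assumption

theorem aut_ext {f g : MulAut (Ostar n)} (h1 : f (x n) = g (x n)) (h2 : f (p n) = g (p n))
    (h3 : f (q n) = g (q n)) (h4 : f (r n) = g (r n)) : f = g := by
  have : f.toMonoidHom = g.toMonoidHom := hext h1 h2 h3 h4
  ext t
  exact DFunLike.congr_fun this t

theorem gen (n : ℕ) : Subgroup.closure {x n, p n, q n, r n} = ⊤ := by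
  rw [eq_top_iff, ← PresentedGroup.closure_range_of, Subgroup.closure_le]
  rintro _ ⟨(_ | _ | _ | _), rfl⟩ <;> exact Subgroup.subset_closure (by simp)

theorem dih_rel (n : ℕ) :
    OR n (DihedralGroup.r 1 : DihedralGroup (3 ^ n)) 1 1 (DihedralGroup.sr 0) where
  hx := DihedralGroup.r_one_pow_n
  p4 := by simp
  pq2 := by simp
  qr2 := by simp [pow_two]
  pq := by simp
  xp := by simp
  xq := by simp
  rx := by simp
  rp := by simp
  rq := by simp

theorem exists_d (n : ℕ) : ∃ d : Ostar n →* DihedralGroup (3 ^ n),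
    d (x n) = DihedralGroup.r 1 ∧ d (p n) = 1 ∧ d (q n) = 1 ∧ d (r n) = DihedralGroup.sr 0 :=
  exists_lift (dih_rel n)

/-- the homomorphism to the dihedral group -/
noncomputable def d (n : ℕ) : Ostar n →* DihedralGroup (3 ^ n) := (exists_d n).choose
theorem dx : d n (x n) = DihedralGroup.r 1 := (exists_d n).choose_spec.1
theorem dp : d n (p n) = 1 := (exists_d n).choose_spec.2.1
theorem dq : d n (q n) = 1 := (exists_d n).choose_spec.2.2.1
theorem dr : d n (r n) = DihedralGroup.sr 0 := (exists_d n).choose_spec.2.2.2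

theorem x_zpow (k : ℤ) : x n ^ k = 1 ↔ (k : ZMod (3 ^ n)) = 0 := by
  constructor
  · intro h
    have := congrArg (d n) h
    rw [map_zpow, dx, map_one, DihedralGroup.r_one_zpow, DihedralGroup.one_def] at this
    exact DihedralGroup.r.inj this
  · intro h
    rw [ZMod.intCast_zmod_eq_zero_iff_dvd] at h
    obtain ⟨m, rfl⟩ := h
    rw [zpow_mul, zpow_natCast, (rel n).hx, one_zpow]

theorem ker_d {g : Ostar n} (hg : d n g = 1) :
    ∃ (a : Fin 4) (b : Fin 2), g = p n ^ (a : ℕ) * q n ^ (b : ℕ) := by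
  obtain ⟨k, a, b, i, j, rfl⟩ := (rel n).word (gen n) g
  refine ⟨a, b, ?_⟩
  simp only [map_mul, map_zpow, map_pow, dx, dp, dq, dr, one_pow, one_mul] at hg
  rw [DihedralGroup.r_one_zpow, DihedralGroup.r_one_pow] at hg
  have hj : j = 0 := by
    by_contra hj
    have : j = 1 := by omega
    subst this
    rw [DihedralGroup.one_def] at hg
    simp only [Fin.val_one, pow_one, DihedralGroup.r_mul_sr] at hg
    cases hg
  subst hj
  rw [DihedralGroup.one_def] at hg
  simp only [Fin.val_zero, pow_zero, mul_one, DihedralGroup.r_mul_r] at hg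
  have h1 := DihedralGroup.r.inj hg
  have h2 : x n ^ (3 * k + (i : ℕ) : ℤ) = 1 := by
    rw [x_zpow]; exact_mod_cast h1
  have hc : Commute (x n ^ (3 * k)) (p n ^ (a : ℕ) * q n ^ (b : ℕ)) := by
    rw [zpow_mul]
    have c1 := (rel n).x3p; have c2 := (rel n).x3q
    exact_mod_cast ((c1.pow_right a).mul_right (c2.pow_right b)).zpow_left k
  rw [zpow_add, zpow_natCast] at h2
  simp only [Fin.val_zero, pow_zero, mul_one]
  rw [← mul_assoc, hc.eq, mul_assoc, h2, mul_one]

/-- the homomorphism to matrices -/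
theorem exists_f (hn : 1 ≤ n) : ∃ f : Ostar n →* M7,
    f (x n) = M7.X ∧ f (p n) = M7.P ∧ f (q n) = M7.Q ∧ f (r n) = M7.R :=
  exists_lift (M7.rels hn)

theorem f_inj {f : Ostar n →* M7} (fp : f (p n) = M7.P) (fq : f (q n) = M7.Q)
    {g : Ostar n} (hd : d n g = 1) (hf : f g = 1) : g = 1 := by
  obtain ⟨a, b, rfl⟩ := ker_d hd
  rw [map_mul, map_pow, map_pow, fp, fq] at hf
  obtain ⟨rfl, rfl⟩ := M7.PQ_inj a b hf
  simp

theorem p2_ne (hn : 1 ≤ n) : p n ^ 2 ≠ 1 := by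
  obtain ⟨f, -, fp, -, -⟩ := exists_f hn
  intro h
  have := congrArg f h
  rw [map_pow, fp, map_one] at this
  exact absurd this (by decide)

theorem p2_x : Commute (p n ^ 2) (x n) := by
  have h := rel n
  have : SemiconjBy (x n) (p n) (q n) := h.xp
  have := this.pow_right 2
  rw [← h.pq2] at this
  exact this.symm

theorem p2_r : Commute (p n ^ 2) (r n) := by
  rw [(rel n).pq2, (rel n).qr2]
  exact (Commute.refl _).pow_left 2

theorem p2_q : Commute (p n ^ 2) (q n) := by
  rw [(rel n).pq2]
  exact (Commute.refl _).pow_left 2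

theorem p2_p : Commute (p n ^ 2) (p n) := (Commute.refl _).pow_left 2

theorem x3k_p (k : ℤ) : Commute (x n ^ (3 * k)) (p n) := by
  rw [zpow_mul]; exact_mod_cast (rel n).x3p.zpow_left k

theorem x3k_q (k : ℤ) : Commute (x n ^ (3 * k)) (q n) := by
  rw [zpow_mul]; exact_mod_cast (rel n).x3q.zpow_left k

theorem cent (hn : 1 ≤ n) {g : Ostar n} (h1 : g * p n = p n * g) (h2 : g * q n = q n * g) :
    ∃ (k : ℤ) (e : Fin 2), g = (p n ^ 2) ^ (e : ℕ) * x n ^ (3 * k) := by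
  obtain ⟨f, fx, fp, fq, fr⟩ := exists_f hn
  obtain ⟨k, a, b, i, j, hg⟩ := (rel n).word (gen n) g
  have hfg : f g = M7.W a b i j := by
    rw [hg]
    simp only [map_mul, map_zpow, map_pow, fx, fp, fq, fr]
    rw [zpow_mul]
    have : M7.X ^ (3 : ℤ) = 1 := by exact_mod_cast M7.X3
    rw [this, one_zpow, one_mul]; rfl
  have e1 := congrArg f h1
  have e2 := congrArg f h2
  simp only [map_mul, fp, fq, hfg] at e1 e2
  obtain ⟨rfl, rfl, rfl, rfl | rfl⟩ := M7.W_comm a b i j e1 e2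
  · exact ⟨k, 0, by rw [hg]; simp⟩
  · refine ⟨k, 1, ?_⟩
    rw [hg]
    simpa using ((x3k_p k).pow_right 2).eq

theorem d_aut (α : MulAut (Ostar n)) : d n (α (p n)) = 1 ∧ d n (α (q n)) = 1 := by
  have hxp := congrArg (fun t => d n (α t)) (rel n).xp
  have hxq := congrArg (fun t => d n (α t)) (rel n).xq
  have hp4 := congrArg (fun t => d n (α t)) (rel n).p4
  simp only [map_mul, map_pow, map_one] at hxp hxq hp4
  generalize d n (α (p n)) = P at *
  generalize d n (α (q n)) = Q at *
  generalize d n (α (x n)) = X at *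
  have hP : P = 1 := by
    rcases P with u | u
    · rw [DihedralGroup.r_pow, DihedralGroup.one_def] at hp4
      have := DihedralGroup.r.inj hp4
      have h4 : IsUnit ((4 : ℕ) : ZMod (3 ^ n)) := by
        rw [ZMod.isUnit_iff_coprime]
        exact Nat.Coprime.pow_right n (by norm_num)
      rw [h4.mul_left_eq_zero] at this
      rw [this, DihedralGroup.one_def]
    · exfalso
      rcases X with w | w <;> rcases Q with v | v <;> simp at hxp hxq
  subst hP
  refine ⟨rfl, ?_⟩
  rw [mul_one] at hxp
  exact right_eq_mul.mp hxp

theorem fixPQ (hn : 1 ≤ n) (α : MulAut (Ostar n)) :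
    ∃ g, g * p n = α (p n) * g ∧ g * q n = α (q n) * g := by
  obtain ⟨f, fx, fp, fq, fr⟩ := exists_f hn
  obtain ⟨d1, d2⟩ := d_aut α
  obtain ⟨a, b, hab⟩ := ker_d d1
  obtain ⟨c, e, hce⟩ := ker_d d2
  have f1 : f (α (p n)) = M7.P ^ (a : ℕ) * M7.Q ^ (b : ℕ) := by
    rw [hab, map_mul, map_pow, map_pow, fp, fq]
  have f2 : f (α (q n)) = M7.P ^ (c : ℕ) * M7.Q ^ (e : ℕ) := by
    rw [hce, map_mul, map_pow, map_pow, fp, fq]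
  have k1 : (f (α (p n))) ^ 2 ≠ 1 := by
    intro h
    rw [← map_pow] at h
    have := f_inj fp fq (by rw [map_pow, d1, one_pow]) h
    rw [← map_pow, EmbeddingLike.map_eq_one_iff] at this
    exact p2_ne hn this
  have k2 : (f (α (p n))) ^ 2 = (f (α (q n))) ^ 2 := by
    rw [← map_pow, ← map_pow, ← map_pow, ← map_pow, (rel n).pq2]
  have k3 : f (α (p n)) * f (α (q n)) ≠ f (α (q n)) * f (α (p n)) := by
    intro h
    have h' : f (α (p n) * α (q n) * (α (q n) * α (p n))⁻¹) = 1 := by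
      rw [map_mul, map_inv, map_mul, map_mul, h, mul_inv_cancel]
    have := f_inj fp fq (by simp [d1, d2]) h'
    rw [← map_mul, ← map_mul, ← map_inv, ← map_mul, EmbeddingLike.map_eq_one_iff,
      mul_inv_eq_one] at this
    have := congrArg f this
    rw [map_mul, map_mul, fp, fq] at this
    exact absurd this (by decide)
  rw [f1] at k1 k2 k3
  rw [f2] at k2 k3
  obtain ⟨b₁, a₁, i, j, w1, w2⟩ := M7.W_trans a b c e k1 k2 k3
  obtain ⟨g, hg⟩ : ∃ g, f g = M7.W a₁ b₁ i j :=
    ⟨p n ^ (a₁ : ℕ) * q n ^ (b₁ : ℕ) * x n ^ (i : ℕ) * r n ^ (j : ℕ), by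
      simp only [map_mul, map_pow, fx, fp, fq, fr]; rfl⟩
  refine ⟨g, ?_, ?_⟩
  · have : g * p n * g⁻¹ * (α (p n))⁻¹ = 1 := by
      apply f_inj fp fq
      · simp [d1, dp]
      · simp only [map_mul, map_inv, hg, fp, w1, f1]; group
    exact mul_inv_eq_iff_eq_mul.mp (mul_inv_eq_one.mp this)
  · have : g * q n * g⁻¹ * (α (q n))⁻¹ = 1 := by
      apply f_inj fp fq
      · simp [d2, dq]
      · simp only [map_mul, map_inv, hg, fq, w2, f2]; group
    exact mul_inv_eq_iff_eq_mul.mp (mul_inv_eq_one.mp this)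

end Ostar

namespace Ostar
variable {n : ℕ}

theorem exists_phi (n : ℕ) : ∃ φ : MulAut (Ostar n),
    φ (x n) = x n ∧ φ (p n) = p n ∧ φ (q n) = q n ∧ φ (r n) = (r n)⁻¹ := by
  obtain ⟨f, h1, h2, h3, h4⟩ := exists_lift (rel n).phi
  have h : f.comp f = MonoidHom.id _ := by
    apply hext <;> simp [h1, h2, h3, h4]
  exact ⟨f.toMulEquiv f h h, h1, h2, h3, h4⟩

theorem x_zpow_eq (a b : ℤ) : x n ^ a = x n ^ b ↔ (a : ZMod (3 ^ n)) = b := by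
  rw [← sub_eq_zero (a := (a : ZMod (3 ^ n))), ← Int.cast_sub, ← x_zpow, zpow_sub, mul_inv_eq_one]

theorem exists_psi (hn : 1 ≤ n) : ∃ ψ : MulAut (Ostar n),
    ψ (x n) = x n ^ 4 ∧ ψ (p n) = p n ∧ ψ (q n) = q n ∧ ψ (r n) = r n := by
  obtain ⟨f, h1, h2, h3, h4⟩ := exists_lift (rel n).psi
  let s : Monoid.End (Ostar n) := f
  have hx : ∀ k : ℕ, (s ^ k) (x n) = x n ^ 4 ^ k := by
    intro k
    induction k with
    | zero => simp
    | succ k ih =>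
      rw [pow_succ]
      show (s ^ k) (f (x n)) = _
      rw [h1, map_pow, ih, ← pow_mul, ← pow_succ]
  have hfix : ∀ t, f t = t → ∀ k : ℕ, (s ^ k) t = t := by
    intro t ht k
    induction k with
    | zero => simp
    | succ k ih =>
      rw [pow_succ]
      show (s ^ k) (f t) = _
      rw [ht, ih]
  have hone : s ^ 3 ^ (n - 1) = 1 := by
    apply hext
    · refine (hx _).trans ?_
      obtain ⟨v, hv⟩ := four_pow_three_pow (n - 1)
      rw [Nat.sub_add_cancel hn] at hv
      show _ = x n
      have : x n ^ ((4 : ℤ) ^ 3 ^ (n - 1)) = x n := by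
        have e : x n ^ ((3 : ℤ) ^ n) = 1 := by exact_mod_cast (rel n).hx
        rw [hv, zpow_add, zpow_mul, e, one_zpow, zpow_one, mul_one]
      exact_mod_cast this
    · exact hfix _ h2 _
    · exact hfix _ h3 _
    · exact hfix _ h4 _
  obtain ⟨m, hm⟩ : ∃ m, 3 ^ (n - 1) = m + 1 :=
    ⟨3 ^ (n - 1) - 1, (Nat.sub_add_cancel (Nat.pow_pos (n := n - 1) (show 0 < 3 by norm_num))).symm⟩
  rw [hm] at hone
  have e1 : (s ^ m).comp f = MonoidHom.id _ := by
    rw [pow_succ] at hone; exact hone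
  have e2 : f.comp (s ^ m) = MonoidHom.id _ := by
    rw [pow_succ'] at hone; exact hone
  exact ⟨f.toMulEquiv (s ^ m) e1 e2, h1, h2, h3, h4⟩

theorem orderOf_four (hn : 1 ≤ n) : orderOf (4 : ZMod (3 ^ n)) = 3 ^ (n - 1) := by
  obtain ⟨m, rfl⟩ : ∃ m, n = m + 1 := ⟨n - 1, by omega⟩
  have := ZMod.orderOf_one_add_prime Nat.prime_three (by norm_num) m
  have e : (1 + ((3 : ℕ) : ZMod (3 ^ (m + 1)))) = 4 := by push_cast; norm_num
  rw [e] at this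
  simpa using this

theorem decomp (hn : 1 ≤ n) {φ ψ : MulAut (Ostar n)}
    (fx : φ (x n) = x n) (fp : φ (p n) = p n) (fq : φ (q n) = q n) (fr : φ (r n) = (r n)⁻¹)
    (sp : ψ (p n) = p n) (sq : ψ (q n) = q n) (sr : ψ (r n) = r n)
    (sxk : ∀ k : ℕ, (ψ ^ k) (x n) = x n ^ 4 ^ k)
    (α : MulAut (Ostar n)) : ∃ (g : Ostar n) (m e : ℕ), α = MulAut.conj g * (ψ ^ m * φ ^ e) := by
  -- first normalise on `P`, `Q`
  obtain ⟨g, g1, g2⟩ := fixPQ hn α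
  obtain ⟨β, hβ⟩ : ∃ β : MulAut (Ostar n), β = MulAut.conj g⁻¹ * α := ⟨_, rfl⟩
  have bp : β (p n) = p n := by
    rw [hβ, MulAut.mul_apply, MulAut.conj_apply, inv_inv, mul_assoc, ← g1]; group
  have bq : β (q n) = q n := by
    rw [hβ, MulAut.mul_apply, MulAut.conj_apply, inv_inv, mul_assoc, ← g2]; group
  have hαβ : α = MulAut.conj g * β := by
    rw [hβ, ← mul_assoc, ← map_mul]; simp
  -- the image of `X`
  have bx : ∃ l : ℤ, β (x n) = x n ^ (1 + 3 * l) := by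
    have hP := congrArg β (rel n).xip
    have hQ := congrArg β (rel n).xiq
    simp only [map_mul, map_inv, bp, bq] at hP hQ
    have c1 : (x n * (β (x n))⁻¹) * p n = p n * (x n * (β (x n))⁻¹) := by
      rw [mul_assoc, hP, ← mul_assoc, ← mul_assoc, (rel n).xp, mul_assoc (q n), (rel n).xq]
      have e : q n * p n * q n = p n := by rw [mul_assoc, (rel n).pq]; group
      rw [← mul_assoc, ← mul_assoc, e, mul_assoc]
    have c2 : (x n * (β (x n))⁻¹) * q n = q n * (x n * (β (x n))⁻¹) := by
      rw [mul_assoc, hQ, ← mul_assoc, (rel n).xp, mul_assoc]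
    obtain ⟨k, e, he⟩ := cent hn c1 c2
    have hx : β (x n) = x n ^ (-(3 * k)) * ((p n ^ 2) ^ (e : ℕ))⁻¹ * x n := by
      have : β (x n) = (x n * (β (x n))⁻¹)⁻¹ * x n := by group
      rw [this, he]; group
    have hc : Commute ((p n ^ 2) ^ (e : ℕ)) (x n) := p2_x.pow_left _
    have hx2 : β (x n) = x n ^ (1 + 3 * (-k)) * ((p n ^ 2) ^ (e : ℕ))⁻¹ := by
      rw [hx, mul_assoc, hc.inv_left.eq, ← mul_assoc, ← zpow_add_one]
      congr 2; ring
    have h3 : (β (x n)) ^ 3 ^ n = 1 := by rw [← map_pow, (rel n).hx, map_one]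
    have hc2 : Commute (x n ^ (1 + 3 * (-k))) ((p n ^ 2) ^ (e : ℕ))⁻¹ :=
      (hc.symm.zpow_left _).inv_right
    rw [hx2, hc2.mul_pow] at h3
    have hx1 : (x n ^ (1 + 3 * (-k))) ^ 3 ^ n = 1 := by
      rw [← zpow_natCast, ← zpow_mul, mul_comm, zpow_mul, zpow_natCast, (rel n).hx, one_zpow]
    rw [hx1, one_mul, inv_pow, inv_eq_one] at h3
    refine ⟨-k, ?_⟩
    have he0 : e = 0 := by
      by_contra hne
      have : e = 1 := by omega
      subst this
      obtain ⟨w, hw⟩ : Odd (3 ^ n) := Odd.pow (by decide)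
      rw [hw] at h3
      have h4 : (p n ^ 2) ^ 2 = 1 := by rw [← pow_mul]; exact (rel n).p4
      rw [Fin.val_one, pow_one, pow_succ, pow_mul, h4, one_pow, one_mul] at h3
      exact p2_ne hn h3
    subst he0
    simpa using hx2
  obtain ⟨l, bx⟩ := bx
  -- the image of `R`
  have br : ∃ (k : ℤ) (e : Fin 2), β (r n) = (p n ^ 2) ^ (e : ℕ) * x n ^ (3 * k) * r n := by
    have hP := congrArg β (rel n).rp
    have hQ := congrArg β (rel n).rq
    simp only [map_mul, map_inv, bp, bq] at hP hQ
    have c1 : (β (r n) * (r n)⁻¹) * p n = p n * (β (r n) * (r n)⁻¹) := by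
      have hs : SemiconjBy (β (r n)) (p n) (q n * p n) := hP
      have ht : SemiconjBy (β (r n)) (q n) ((q n)⁻¹) := hQ
      have := (ht.mul_right hs).mul_left (show SemiconjBy (r n)⁻¹ (p n) (q n * p n) from (rel n).rip)
      rw [inv_mul_cancel_left] at this
      exact this
    have c2 : (β (r n) * (r n)⁻¹) * q n = q n * (β (r n) * (r n)⁻¹) := by
      have ht : SemiconjBy (β (r n)) (q n) ((q n)⁻¹) := hQ
      have ht2 := ht.inv_right
      rw [inv_inv] at ht2
      exact ht2.mul_left (show SemiconjBy (r n)⁻¹ (q n) (q n)⁻¹ from (rel n).riq)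
    obtain ⟨k, e, he⟩ := cent hn c1 c2
    exact ⟨k, e, by rw [← he]; group⟩
  obtain ⟨k, e, br⟩ := br
  -- the exponent of `ψ`
  obtain ⟨m, hm⟩ := exists_four_pow (n - 1) l
  rw [Nat.sub_add_cancel hn] at hm
  have hxm : x n ^ (1 + 3 * l) = x n ^ 4 ^ m := by
    have : x n ^ (1 + 3 * l) = x n ^ ((4 : ℤ) ^ m) := by
      rw [x_zpow_eq, eq_comm, ← sub_eq_zero, ← Int.cast_sub, ZMod.intCast_zmod_eq_zero_iff_dvd]
      exact_mod_cast hm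
    rw [this]; exact_mod_cast rfl
  -- halving
  obtain ⟨w, hw⟩ : Odd (3 ^ n) := Odd.pow (by decide)
  have hhalf : x n ^ (2 * (3 * (k * (w + 1)))) = x n ^ (3 * k) := by
    rw [x_zpow_eq, ← sub_eq_zero, ← Int.cast_sub, ZMod.intCast_zmod_eq_zero_iff_dvd]
    refine ⟨3 * k, ?_⟩
    rw [hw]; push_cast; ring
  have hfix : ∀ (γ : MulAut (Ostar n)) (t : Ostar n), γ t = t → ∀ j : ℕ, (γ ^ j) t = t := by
    intro γ t ht j
    induction j with
    | zero => simp
    | succ j ih => rw [pow_succ, MulAut.mul_apply, ht, ih]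
  have hr : r n * x n ^ (-(3 * (k * (w + 1)))) = x n ^ (3 * (k * (w + 1))) * r n := by
    have : SemiconjBy (r n) (x n) (x n)⁻¹ := (rel n).rx
    have := this.zpow_right (-(3 * (k * (w + 1))))
    rw [inv_zpow', neg_neg] at this
    exact this
  refine ⟨g * x n ^ (3 * (k * (w + 1))), m, e, ?_⟩
  rw [hαβ, map_mul, mul_assoc]
  congr 1
  apply aut_ext
  · rw [MulAut.mul_apply, MulAut.mul_apply, hfix φ _ fx, sxk, bx, hxm, MulAut.conj_apply]
    have : Commute (x n ^ (3 * (k * (w + 1)))) (x n ^ 4 ^ m) :=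
      ((Commute.refl (x n)).zpow_left _).pow_right _
    rw [this.eq]; group
  · rw [MulAut.mul_apply, MulAut.mul_apply, hfix φ _ fp, hfix ψ _ sp, bp, MulAut.conj_apply,
      (x3k_p _).eq]; group
  · rw [MulAut.mul_apply, MulAut.mul_apply, hfix φ _ fq, hfix ψ _ sq, bq, MulAut.conj_apply,
      (x3k_q _).eq]; group
  · have hphi : (φ ^ (e : ℕ)) (r n) = (p n ^ 2) ^ (e : ℕ) * r n := by
      have : e = 0 ∨ e = 1 := by omega
      rcases this with rfl | rfl
      · simp
      · rw [Fin.val_one, pow_one, pow_one, fr, (rel n).pq2, (rel n).qr2]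
        have h4 : r n ^ 4 = 1 := by
          rw [show 4 = 2 * 2 from rfl, pow_mul, ← (rel n).qr2, ← (rel n).pq2, ← pow_mul]
          exact (rel n).p4
        rw [inv_eq_iff_mul_eq_one, ← pow_succ, ← pow_succ', h4]
    have hc : Commute ((p n ^ 2) ^ (e : ℕ)) (x n ^ (3 * (k * (w + 1)))) :=
      (p2_x.pow_left _).zpow_right _
    rw [MulAut.mul_apply, MulAut.mul_apply, hphi, map_mul, map_pow, map_pow, hfix ψ _ sp,
      hfix ψ _ sr, br, MulAut.conj_apply, ← hhalf, ← zpow_neg]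
    rw [← mul_assoc (x n ^ (3 * (k * (w + 1)))), ← hc.eq, mul_assoc _ (r n), hr, two_mul, zpow_add]
    simp only [mul_assoc]

theorem disj (hn : 1 ≤ n) (g : Ostar n) (γ : MulAut (Ostar n)) (h : MulAut.conj g = γ)
    (hp : γ (p n) = p n) (hq : γ (q n) = q n) (hr : γ (r n) = r n ∨ γ (r n) = (r n)⁻¹) :
    γ = 1 := by
  subst h
  rw [MulAut.conj_apply, mul_inv_eq_iff_eq_mul] at hp hq
  obtain ⟨k, e, rfl⟩ := cent hn hp hq
  have hrx : r n * (x n ^ (3 * k))⁻¹ = x n ^ (3 * k) * r n := by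
    have : SemiconjBy (r n) (x n) (x n)⁻¹ := (rel n).rx
    have := this.zpow_right (-(3 * k))
    rw [inv_zpow', neg_neg, zpow_neg] at this
    exact this
  have hz : Commute ((p n ^ 2) ^ (e : ℕ)) (r n) := p2_r.pow_left _
  have hzx : Commute ((p n ^ 2) ^ (e : ℕ)) (x n) := p2_x.pow_left _
  have hval : MulAut.conj ((p n ^ 2) ^ (e : ℕ) * x n ^ (3 * k)) (r n) = x n ^ (2 * (3 * k)) * r n := by
    rw [MulAut.conj_apply, mul_inv_rev]
    calc (p n ^ 2) ^ (e : ℕ) * x n ^ (3 * k) * r n * ((x n ^ (3 * k))⁻¹ * ((p n ^ 2) ^ (e : ℕ))⁻¹)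
        = (p n ^ 2) ^ (e : ℕ) * x n ^ (3 * k) * (r n * (x n ^ (3 * k))⁻¹) *
          ((p n ^ 2) ^ (e : ℕ))⁻¹ := by simp only [mul_assoc]
      _ = (p n ^ 2) ^ (e : ℕ) * (x n ^ (2 * (3 * k)) * r n) * ((p n ^ 2) ^ (e : ℕ))⁻¹ := by
          rw [hrx, two_mul, zpow_add]; simp only [mul_assoc]
      _ = _ := by
          rw [((hzx.zpow_right _).mul_right hz).eq]; group
  rw [hval] at hr
  have h4 : x n ^ (4 * (3 * k)) = 1 := by
    have e4 : (4 * (3 * k)) = 2 * (3 * k) * (2 : ℤ) := by ring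
    rw [e4, zpow_mul]
    rcases hr with hr | hr
    · rw [mul_eq_right] at hr; rw [hr, one_zpow]
    · have : x n ^ (2 * (3 * k)) = (p n ^ 2)⁻¹ := by
        rw [(rel n).pq2, (rel n).qr2, eq_mul_inv_of_mul_eq hr]; group
      rw [this]
      have h4 : (p n ^ 2) ^ 2 = 1 := by rw [← pow_mul]; exact (rel n).p4
      rw [inv_zpow]
      exact_mod_cast inv_eq_one.mpr h4
  have h3 : x n ^ (3 * k) = 1 := by
    rw [x_zpow] at h4 ⊢
    rw [Int.cast_mul] at h4
    have hu : IsUnit ((4 : ℕ) : ZMod (3 ^ n)) := by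
      rw [ZMod.isUnit_iff_coprime]
      exact Nat.Coprime.pow_right n (by norm_num)
    have hu' : IsUnit ((4 : ℤ) : ZMod (3 ^ n)) := by exact_mod_cast hu
    exact hu'.mul_right_eq_zero.mp h4
  rw [h3, mul_one]
  have key : ∀ t, Commute (p n ^ 2) t →
      MulAut.conj ((p n ^ 2) ^ (e : ℕ)) t = (1 : MulAut (Ostar n)) t := by
    intro t ht
    rw [MulAut.conj_apply, (ht.pow_left _).eq, mul_inv_cancel_right, MulAut.one_apply]
  exact aut_ext (key _ p2_x) (key _ p2_p) (key _ p2_q) (key _ p2_r)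

end Ostar
open PresentedGroup OGen in
/-- For n ≥ 1: the subgroup Inn(O*ₙ) of inner automorphisms (the range of the conjugation
homomorphism) is normal in Aut(O*ₙ), and the extension
1 → Inn(O*ₙ) → Aut(O*ₙ) → ℤ/2 × ℤ/3^(n-1) → 1 is split: there are automorphisms φ, ψ
determined on generators by φ(P) = P, φ(Q) = Q, φ(X) = X, φ(R) = R⁻¹ and ψ(P) = P,
ψ(Q) = Q, ψ(X) = X⁴, ψ(R) = R, such that the subgroup they generate is isomorphic to
ℤ/2 × ℤ/3^(n-1) and is a complement of Inn(O*ₙ) in Aut(O*ₙ); in particular it intersects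
Inn(O*ₙ) trivially and maps isomorphically onto the quotient
Aut(O*ₙ)/Inn(O*ₙ) ≅ ℤ/2 × ℤ/3^(n-1). -/
theorem aut_Ostar_structure (n : ℕ) (hn : 1 ≤ n) :
    (MulAut.conj (G := Ostar n)).range.Normal ∧
    ∃ φ ψ : MulAut (Ostar n),
      φ (of P) = of P ∧ φ (of Q) = of Q ∧ φ (of X) = of X ∧
        φ (of R) = (of R : Ostar n)⁻¹ ∧
      ψ (of P) = of P ∧ ψ (of Q) = of Q ∧ ψ (of X) = (of X : Ostar n) ^ 4 ∧
        ψ (of R) = of R ∧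
      Nonempty ((Subgroup.closure {φ, ψ} : Subgroup (MulAut (Ostar n))) ≃*
        Multiplicative (ZMod 2) × Multiplicative (ZMod (3 ^ (n - 1)))) ∧
      Subgroup.IsComplement' (MulAut.conj (G := Ostar n)).range
        (Subgroup.closure {φ, ψ}) := by
  refine ⟨⟨?_⟩, ?_⟩
  · rintro _ ⟨g, rfl⟩ α
    refine ⟨α g, ?_⟩
    ext t
    simp [MulAut.conj_apply]
  obtain ⟨φ, fx, fp, fq, fr⟩ := Ostar.exists_phi n
  obtain ⟨ψ, sx, sp, sq, sr⟩ := Ostar.exists_psi hn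
  refine ⟨φ, ψ, fp, fq, fx, fr, sp, sq, sx, sr, ?_⟩
  have sxk : ∀ k : ℕ, (ψ ^ k) (Ostar.x n) = Ostar.x n ^ 4 ^ k := by
    intro k
    induction k with
    | zero => simp
    | succ k ih => rw [pow_succ, MulAut.mul_apply, sx, map_pow, ih, ← pow_mul, ← pow_succ]
  have hfix : ∀ (γ : MulAut (Ostar n)) (t : Ostar n), γ t = t → ∀ j : ℕ, (γ ^ j) t = t := by
    intro γ t ht j
    induction j with
    | zero => simp
    | succ j ih => rw [pow_succ, MulAut.mul_apply, ht, ih]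
  have hcomm : Commute φ ψ := by
    show φ * ψ = ψ * φ
    apply Ostar.aut_ext <;> simp [MulAut.mul_apply, fx, fp, fq, fr, sx, sp, sq, sr]
  have ordφ : orderOf φ = 2 := by
    apply orderOf_eq_prime
    · apply Ostar.aut_ext <;> simp [pow_two, MulAut.mul_apply, fx, fp, fq, fr]
    · intro h
      rw [h, MulAut.one_apply, eq_inv_iff_mul_eq_one, ← pow_two, ← (Ostar.rel n).qr2,
        ← (Ostar.rel n).pq2] at fr
      exact Ostar.p2_ne hn fr
  have ordψ : orderOf ψ = 3 ^ (n - 1) := by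
    rw [← Ostar.orderOf_four hn, orderOf_eq_orderOf_iff]
    intro k
    have e : (4 : ZMod (3 ^ n)) ^ k = 1 ↔ Ostar.x n ^ ((4 : ℤ) ^ k) = Ostar.x n ^ (1 : ℤ) := by
      rw [Ostar.x_zpow_eq]; push_cast; rfl
    have e2 : Ostar.x n ^ ((4 : ℤ) ^ k) = Ostar.x n ^ 4 ^ k := by
      rw [← zpow_natCast]; push_cast; rfl
    rw [e, e2, zpow_one, ← sxk]
    constructor
    · intro h; rw [h]; rfl
    · intro h
      exact Ostar.aut_ext h (hfix _ _ sp k) (hfix _ _ sq k) (hfix _ _ sr k)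
  have hcop : (orderOf φ).Coprime (orderOf ψ) := by
    rw [ordφ, ordψ]; exact Nat.Coprime.pow_right _ (by norm_num)
  have ordc : orderOf (φ * ψ) = 2 * 3 ^ (n - 1) := by
    rw [hcomm.orderOf_mul_eq_mul_orderOf_of_coprime hcop, ordφ, ordψ]
  have hcl : Subgroup.closure {φ, ψ} = Subgroup.zpowers (φ * ψ) := by
    apply le_antisymm
    · rw [Subgroup.closure_le]
      have hodd : Odd (3 ^ (n - 1)) := Odd.pow (by decide)
      have hφ : φ ∈ Subgroup.zpowers (φ * ψ) := by
        have : (φ * ψ) ^ 3 ^ (n - 1) = φ := by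
          obtain ⟨w, hw⟩ := hodd
          rw [hcomm.mul_pow, ← ordψ, pow_orderOf_eq_one, mul_one, ordψ, hw, pow_succ, pow_mul,
            ← ordφ, pow_orderOf_eq_one, one_pow, one_mul]
        rw [← this]
        exact pow_mem (by rw [this]; exact Subgroup.mem_zpowers _) _
      rintro y (rfl | rfl)
      · exact hφ
      · have := mul_mem (inv_mem hφ) (Subgroup.mem_zpowers (φ * y))
        rwa [inv_mul_cancel_left] at this
    · rw [Subgroup.zpowers_le]
      exact mul_mem (Subgroup.subset_closure (by simp)) (Subgroup.subset_closure (by simp))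
  constructor
  · rw [hcl]
    have hcard : Nat.card (Subgroup.zpowers (φ * ψ)) = 2 * 3 ^ (n - 1) := by
      rw [Nat.card_zpowers, ordc]
    have e1 : Multiplicative (ZMod (2 * 3 ^ (n - 1))) ≃* Subgroup.zpowers (φ * ψ) := by
      rw [← hcard]
      exact zmodCyclicMulEquiv inferInstance
    have hc2 : Nat.Coprime 2 (3 ^ (n - 1)) := Nat.Coprime.pow_right _ (by norm_num)
    have e2 := AddEquiv.toMultiplicative (ZMod.chineseRemainder hc2).toAddEquiv
    exact ⟨e1.symm.trans (e2.trans (MulEquiv.prodMultiplicative _ _))⟩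
  · apply Subgroup.isComplement'_of_disjoint_and_mul_eq_univ
    · rw [Subgroup.disjoint_def]
      rintro γ ⟨g, hg⟩ hγ
      have hall : γ (of P) = of P ∧ γ (of Q) = of Q ∧
          (γ (of R) = of R ∨ γ (of R) = (of R : Ostar n)⁻¹) := by
        rw [hcl] at hγ
        have hfin : IsOfFinOrder (φ * ψ) := by
          rw [← orderOf_pos_iff, ordc]; positivity
        rw [← hfin.mem_powers_iff_mem_zpowers] at hγ
        obtain ⟨k, rfl⟩ := hγ
        have hR : (φ * ψ) (of R) = (of R)⁻¹ := by rw [MulAut.mul_apply, sr, fr]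
        refine ⟨hfix _ _ (by rw [MulAut.mul_apply, sp, fp]) k,
          hfix _ _ (by rw [MulAut.mul_apply, sq, fq]) k, ?_⟩
        show ((φ * ψ) ^ k) (of R) = of R ∨ ((φ * ψ) ^ k) (of R) = (of R)⁻¹
        clear hg
        induction k with
        | zero => left; simp
        | succ k ih =>
          rw [pow_succ, MulAut.mul_apply, hR, map_inv]
          rcases ih with h | h
          · right; rw [h]
          · left; rw [h, inv_inv]
      exact Ostar.disj hn g γ hg hall.1 hall.2.1 hall.2.2
    · rw [Set.eq_univ_iff_forall]
      intro α
      obtain ⟨g, m, e, rfl⟩ := Ostar.decomp hn fx fp fq fr sp sq sr sxk α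
      refine Set.mul_mem_mul ⟨g, rfl⟩ ?_
      exact mul_mem (pow_mem (Subgroup.subset_closure (by simp)) _)
        (pow_mem (Subgroup.subset_closure (by simp)) _)
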